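/- Let W = (V, w) be a weighted digraph, let x be a vertex, let r > 0, and for each s ∈ (0, r) let μ_s be a probability measure on O̅_x whose support is contained in the set O_x of finite paths from x. Assume that for every finite path u ∈ O_x: (1) the limit t_u = lim_{s→r} μ_s({v ∈ O_x : v extends u}) exists, and (2) μ_s({u}) → 0 as s → r. Then the family (μ_s)_{0<s<r} converges weakly, as s → r, to a probability measure μ on O̅_x which is concentrated on the set Ω_x of infinite paths from x, and μ is the unique such measure satisfying μ(↑u) = t_u for all u ∈ O_x. -/

import Mathlib

open Filter Topology MeasureTheory
open scoped ENNReal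

/-- A finite path from `x` in the digraph `(V, w)`, encoded as a nonempty list of vertices
starting at `x` whose consecutive pairs are edges. Its length as a path is `l.length - 1`. -/
def IsPathFrom {V : Type*} (w : V → V → ℝ) (x : V) (l : List V) : Prop :=
  l.head? = some x ∧ l.Chain' (fun a b => 0 < w a b)

/-- The multiplicative weight of a finite path. -/
noncomputable def pathWeight {V : Type*} (w : V → V → ℝ) (l : List V) : ℝ :=
  ((l.zip l.tail).map fun p => w p.1 p.2).prod

/-- The space of (finite or infinite) paths lives inside the sequences over `V ⊎ {†}`,
where `none` plays the role of the dagger symbol. -/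
abbrev PathSeq (V : Type*) := ℕ → Option V

/-- The canonical embedding of a finite path (a list) into the sequence space. -/
def listToSeq {V : Type*} (l : List V) : PathSeq V := fun i => l[i]?

/-- The cylinder of sequences whose initial segment of length `l.length` is `l`. -/
def Cyl {V : Type*} (l : List V) : Set (PathSeq V) := {ω | ∀ i < l.length, ω i = l[i]?}

/-- The set `Ω_x` of infinite paths from `x`, inside the sequence space. -/
def OmegaSet {V : Type*} (w : V → V → ℝ) (x : V) : Set (PathSeq V) :=
  {ω | ∃ f : ℕ → V, f 0 = x ∧ (∀ i, 0 < w (f i) (f (i + 1))) ∧ ∀ i, ω i = some (f i)}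

/-- `↑u`: the set of infinite paths from `x` whose initial segment of length `|u|` is
the finite path `u` (encoded as a list `l`, of path length `l.length - 1`). -/
def UpSet {V : Type*} (w : V → V → ℝ) (x : V) (l : List V) : Set (PathSeq V) :=
  Cyl l ∩ OmegaSet w x

/-- The (embedded) set `O_x(k)` of finite paths from `x` of length `k`. -/
def FinPathsLen {V : Type*} (w : V → V → ℝ) (x : V) (k : ℕ) : Set (PathSeq V) :=
  {ω | ∃ l : List V, IsPathFrom w x l ∧ l.length = k + 1 ∧ ω = listToSeq l}

/-- The (embedded) set `O_x` of all finite paths from `x`. -/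
def FinPaths {V : Type*} (w : V → V → ℝ) (x : V) : Set (PathSeq V) :=
  {ω | ∃ l : List V, IsPathFrom w x l ∧ ω = listToSeq l}

section Instances

variable (V : Type*)

instance : TopologicalSpace (Option V) := ⊥
instance : DiscreteTopology (Option V) := ⟨rfl⟩
instance : MeasurableSpace (Option V) := ⊤
instance : BorelSpace (Option V) := ⟨borel_eq_top_of_discrete.symm⟩

end Instances

theorem mem_omegaSet_iff {V : Type*} {w : V → V → ℝ} {x : V} {ω : PathSeq V} :
    ω ∈ OmegaSet w x ↔
      ω 0 = some x ∧ ∀ i, ∃ a b, ω i = some a ∧ ω (i + 1) = some b ∧ 0 < w a b := by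
  constructor
  · rintro ⟨f, h0, hf, hω⟩
    exact ⟨by rw [hω, h0], fun i => ⟨f i, f (i + 1), hω i, hω (i + 1), hf i⟩⟩
  · rintro ⟨h0, h⟩
    choose a b ha hb hab using h
    refine ⟨a, ?_, fun i => ?_, ha⟩
    · simpa [ha] using h0
    · have : b i = a (i + 1) := by simpa [hb] using ha (i + 1)
      exact this ▸ hab i

theorem isClopen_preimage_eval {V : Type*} (i : ℕ) (s : Set (Option V)) :
    IsClopen {ω : PathSeq V | ω i ∈ s} :=
  (isClopen_discrete s).preimage (continuous_apply i)

theorem isClopen_cyl {V : Type*} (l : List V) : IsClopen (Cyl l) := by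
  have : Cyl l = ⋂ i ∈ Finset.range l.length, {ω : PathSeq V | ω i ∈ ({l[i]?} : Set (Option V))} := by
    ext ω
    simp [Cyl]
  rw [this]
  exact isClopen_biInter_finset fun i _ => isClopen_preimage_eval i _

/-- The sequences whose entries at times `i` and `i + 1` are vertices joined by an edge. -/
def EdgeAt {V : Type*} (w : V → V → ℝ) (i : ℕ) : Set (PathSeq V) :=
  {ω | ∃ a b, ω i = some a ∧ ω (i + 1) = some b ∧ 0 < w a b}

theorem isClopen_edgeAt {V : Type*} [Finite V] (w : V → V → ℝ) (i : ℕ) :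
    IsClopen (EdgeAt w i) := by
  let g : PathSeq V → Option V × Option V := fun ω => (ω i, ω (i + 1))
  have hg : Continuous g := by fun_prop
  exact (isClopen_discrete
    {p : Option V × Option V | ∃ a b, p.1 = some a ∧ p.2 = some b ∧ 0 < w a b}).preimage hg

theorem measurableSet_omegaSet {V : Type*} [Finite V] (w : V → V → ℝ) (x : V) :
    MeasurableSet (OmegaSet w x) := by
  have : OmegaSet w x =
      {ω : PathSeq V | ω 0 ∈ ({some x} : Set (Option V))} ∩ ⋂ i, EdgeAt w i := by
    ext ω
    simp [mem_omegaSet_iff, EdgeAt]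
  rw [this]
  exact (isClopen_preimage_eval 0 _).1.measurableSet.inter
    (MeasurableSet.iInter fun i => (isClopen_edgeAt w i).1.measurableSet)

theorem countable_finPaths {V : Type*} [Countable V] (w : V → V → ℝ) (x : V) :
    (FinPaths w x).Countable :=
  (Set.countable_range (listToSeq (V := V))).mono <| by
    rintro _ ⟨l, -, rfl⟩
    exact ⟨l, rfl⟩

theorem IsPathFrom.listToSeq_zero {V : Type*} {w : V → V → ℝ} {x : V} {l : List V}
    (hl : IsPathFrom w x l) : listToSeq l 0 = some x := by
  simpa [listToSeq, List.head?_eq_getElem?] using hl.1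

theorem IsPathFrom.listToSeq_mem_edgeAt {V : Type*} {w : V → V → ℝ} {x : V} {l : List V}
    (hl : IsPathFrom w x l) {i : ℕ} (hi : i + 1 < l.length) : listToSeq l ∈ EdgeAt w i :=
  ⟨l[i], l[i + 1], by simp [listToSeq], by simp [listToSeq],
    List.isChain_iff_getElem.1 hl.2 i hi⟩

theorem isPathFrom_ofFn {V : Type*} {w : V → V → ℝ} {x : V} {f : ℕ → V} (h0 : f 0 = x)
    (hf : ∀ i, 0 < w (f i) (f (i + 1))) {n : ℕ} (hn : n ≠ 0) :
    IsPathFrom w x (List.ofFn fun i : Fin n => f i) := by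
  refine ⟨?_, List.isChain_iff_getElem.2 fun i hi => ?_⟩
  · rw [List.head?_eq_getElem?]
    simp [h0, Nat.pos_of_ne_zero hn]
  · simpa using hf i

theorem cyl_ofFn {V : Type*} (f : ℕ → V) (n : ℕ) :
    Cyl (List.ofFn fun i : Fin n => f i) = PiNat.cylinder (fun i => some (f i)) n := by
  ext ω
  simp only [Cyl, List.length_ofFn, Set.mem_ofPred_eq, PiNat.mem_cylinder_iff]
  refine forall₂_congr fun i hi => ?_
  simp [hi]

theorem measure_inter_omegaSet {V : Type*} [Finite V] {w : V → V → ℝ} {x : V}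
    {μ : Measure (PathSeq V)} [IsProbabilityMeasure μ] (hμ : μ (OmegaSet w x) = 1)
    (s : Set (PathSeq V)) : μ (s ∩ OmegaSet w x) = μ s := by
  have h : ∀ᵐ ω ∂μ, ω ∈ OmegaSet w x :=
    (mem_ae_iff_prob_eq_one (measurableSet_omegaSet w x)).2 hμ
  exact measure_congr (inter_ae_eq_left_of_ae_eq_univ (eventuallyEq_univ.2 h))

theorem isPiSystem_cylinders (E : ℕ → Type*) :
    IsPiSystem {s : Set (∀ n, E n) | ∃ g n, s = PiNat.cylinder g n} := by
  rintro _ ⟨g, n, rfl⟩ _ ⟨g', n', rfl⟩ ⟨y, hy, hy'⟩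
  rw [← PiNat.mem_cylinder_iff_eq.1 hy, ← PiNat.mem_cylinder_iff_eq.1 hy']
  rcases le_total n n' with h | h
  · exact ⟨y, n', Set.inter_eq_right.2 (PiNat.cylinder_anti y h)⟩
  · exact ⟨y, n, Set.inter_eq_left.2 (PiNat.cylinder_anti y h)⟩

/-- A probability measure concentrated on `Ω_x` is determined by its values on the sets `↑u`. -/
theorem ext_of_upSet {V : Type*} [Finite V] {w : V → V → ℝ} {x : V}
    {μ ν : Measure (PathSeq V)} [IsProbabilityMeasure μ] [IsProbabilityMeasure ν]
    (hμ : μ (OmegaSet w x) = 1) (hν : ν (OmegaSet w x) = 1)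
    (h : ∀ l, IsPathFrom w x l → μ (UpSet w x l) = ν (UpSet w x l)) : μ = ν := by
  refine ext_of_generate_finite {s | ∃ g n, s = PiNat.cylinder g n}
    (BorelSpace.measurable_eq.trans
      (PiNat.isTopologicalBasis_cylinders fun _ : ℕ => Option V).borel_eq_generateFrom)
    (isPiSystem_cylinders _) ?_ (by simp)
  rintro _ ⟨g, n, rfl⟩
  rcases eq_or_ne n 0 with rfl | hn
  · simp
  rw [← measure_inter_omegaSet hμ, ← measure_inter_omegaSet hν]
  rcases (PiNat.cylinder g n ∩ OmegaSet w x).eq_empty_or_nonempty with he | ⟨ω, hω, hΩ⟩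
  · simp [he]
  obtain ⟨f, h0, hf, hωf⟩ := hΩ
  obtain rfl : ω = fun i => some (f i) := funext hωf
  rw [← PiNat.mem_cylinder_iff_eq.1 hω, ← cyl_ofFn]
  exact h _ (isPathFrom_ofFn h0 hf hn)

section Limit

variable {V : Type*} [Finite V] {w : V → V → ℝ} {x : V} {ι : Type*} {L : Filter ι}
  {P : ι → ProbabilityMeasure (PathSeq V)} {μ : ProbabilityMeasure (PathSeq V)}

theorem measure_inter_finPaths {ν : Measure (PathSeq V)} [IsProbabilityMeasure ν]
    (hν : ν (FinPaths w x) = 1) (s : Set (PathSeq V)) : ν (s ∩ FinPaths w x) = ν s := by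
  have h : ∀ᵐ ω ∂ν, ω ∈ FinPaths w x :=
    (mem_ae_iff_prob_eq_one (countable_finPaths w x).measurableSet).2 hν
  exact measure_congr (inter_ae_eq_left_of_ae_eq_univ (eventuallyEq_univ.2 h))

theorem tendsto_measure_compl_edgeAt
    (hsupp : ∀ᶠ s in L, (P s : Measure (PathSeq V)) (FinPaths w x) = 1)
    (hsingleton : ∀ l : List V, IsPathFrom w x l →
      Tendsto (fun s => (P s : Measure (PathSeq V)) {listToSeq l}) L (𝓝 0)) (i : ℕ) :
    Tendsto (fun s => (P s : Measure (PathSeq V)) (EdgeAt w i)ᶜ) L (𝓝 0) := by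
  have hfin : {l : List V | IsPathFrom w x l ∧ l.length ≤ i + 1}.Finite :=
    (List.finite_length_le V (i + 1)).subset fun l hl => hl.2
  have hsub : (EdgeAt w i)ᶜ ∩ FinPaths w x ⊆ ⋃ l ∈ hfin.toFinset, {listToSeq l} := by
    rintro _ ⟨hω, l, hl, rfl⟩
    have : l.length ≤ i + 1 := not_lt.1 fun hi => hω (hl.listToSeq_mem_edgeAt hi)
    simp only [Set.Finite.mem_toFinset, Set.mem_iUnion]
    exact ⟨l, ⟨hl, this⟩, rfl⟩
  have hsum : Tendsto
      (fun s => ∑ l ∈ hfin.toFinset, (P s : Measure (PathSeq V)) {listToSeq l}) L (𝓝 0) := by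
    simpa using tendsto_finsetSum hfin.toFinset fun l hl =>
      hsingleton l (hfin.mem_toFinset.1 hl).1
  refine tendsto_of_tendsto_of_tendsto_of_le_of_le' tendsto_const_nhds hsum
    (Eventually.of_forall fun _ => zero_le) ?_
  filter_upwards [hsupp] with s hs
  rw [← measure_inter_finPaths hs]
  exact (measure_mono hsub).trans (measure_biUnion_finset_le _ _)

theorem limit_measure_isClopen (hP : Tendsto P L (𝓝 μ)) {s : Set (PathSeq V)} (hs : IsClopen s) :
    Tendsto (fun i => (P i : Measure (PathSeq V)) s) L (𝓝 ((μ : Measure (PathSeq V)) s)) :=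
  ProbabilityMeasure.tendsto_measure_of_null_frontier_of_tendsto' hP (by simp [hs.frontier_eq])

theorem limit_omegaSet [L.NeBot] (hP : Tendsto P L (𝓝 μ))
    (hsupp : ∀ᶠ s in L, (P s : Measure (PathSeq V)) (FinPaths w x) = 1)
    (hsingleton : ∀ l : List V, IsPathFrom w x l →
      Tendsto (fun s => (P s : Measure (PathSeq V)) {listToSeq l}) L (𝓝 0)) :
    (μ : Measure (PathSeq V)) (OmegaSet w x) = 1 := by
  rw [← mem_ae_iff_prob_eq_one (measurableSet_omegaSet w x)]
  have h0 : ∀ᵐ ω ∂(μ : Measure (PathSeq V)), ω 0 = some x := by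
    have hc := isClopen_preimage_eval 0 ({some x}ᶜ : Set (Option V))
    refine tendsto_nhds_unique (limit_measure_isClopen hP hc)
      (tendsto_const_nhds.congr' ?_)
    filter_upwards [hsupp] with s hs
    rw [← measure_inter_finPaths hs]
    refine (measure_mono_null ?_ measure_empty).symm
    rintro _ ⟨hω, l, hl, rfl⟩
    exact hω hl.listToSeq_zero
  have he : ∀ᵐ ω ∂(μ : Measure (PathSeq V)), ∀ i, ω ∈ EdgeAt w i := by
    refine ae_all_iff.2 fun i => ?_
    exact tendsto_nhds_unique (limit_measure_isClopen hP (isClopen_edgeAt w i).compl)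
      (tendsto_measure_compl_edgeAt hsupp hsingleton i)
  filter_upwards [h0, he] with ω h h'
  exact mem_omegaSet_iff.2 ⟨h, h'⟩

theorem limit_upSet [L.NeBot] (hP : Tendsto P L (𝓝 μ))
    (hsupp : ∀ᶠ s in L, (P s : Measure (PathSeq V)) (FinPaths w x) = 1)
    (hΩ : (μ : Measure (PathSeq V)) (OmegaSet w x) = 1) {l : List V} {t : ℝ}
    (hconv : Tendsto (fun s => ((P s : Measure (PathSeq V)) (Cyl l ∩ FinPaths w x)).toReal)
      L (𝓝 t)) :
    (μ : Measure (PathSeq V)) (UpSet w x l) = ENNReal.ofReal t := by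
  rw [UpSet, measure_inter_omegaSet hΩ]
  refine tendsto_nhds_unique (limit_measure_isClopen hP (isClopen_cyl l))
    ((ENNReal.tendsto_ofReal hconv).congr' ?_)
  filter_upwards [hsupp] with s hs
  rw [ENNReal.ofReal_toReal (measure_ne_top _ _), measure_inter_finPaths hs]

end Limit

/-- (Lemma 1, point 2.) If `(μ_s)_{0<s<r}` are probability measures
supported on `O_x` such that `μ_s(extensions of u) → t_u` and `μ_s({u}) → 0` as `s → r`
for every finite path `u ∈ O_x`, then `μ_s` converges weakly as `s → r` to the unique
probability measure `μ` concentrated on `Ω_x` with `μ(↑u) = t_u` for all `u ∈ O_x`. -/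
theorem weak_convergence_of_boltzmann_type_distributions {V : Type*} [Fintype V] [DecidableEq V]
    [Nonempty V]
    (w : V → V → ℝ) (hw : ∀ a b, 0 ≤ w a b) (x : V) (r : ℝ) (hr : 0 < r)
    (μs : ℝ → Measure (PathSeq V)) (hprob : ∀ s ∈ Set.Ioo 0 r, IsProbabilityMeasure (μs s))
    (hsupp : ∀ s ∈ Set.Ioo 0 r, μs s (FinPaths w x) = 1)
    (t : List V → ℝ)
    (hconv : ∀ l : List V, IsPathFrom w x l →
      Tendsto (fun s : ℝ => (μs s (Cyl l ∩ FinPaths w x)).toReal)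
        (nhdsWithin r (Set.Ioo 0 r)) (nhds (t l)))
    (hsingleton : ∀ l : List V, IsPathFrom w x l →
      Tendsto (fun s : ℝ => (μs s {listToSeq l}).toReal)
        (nhdsWithin r (Set.Ioo 0 r)) (nhds 0)) :
    ∃ μ : Measure (PathSeq V), IsProbabilityMeasure μ ∧ μ (OmegaSet w x) = 1 ∧
      (∀ f : C(PathSeq V, ℝ), Tendsto (fun s : ℝ => ∫ ω, f ω ∂(μs s))
        (nhdsWithin r (Set.Ioo 0 r)) (nhds (∫ ω, f ω ∂μ))) ∧
      (∀ l : List V, IsPathFrom w x l → μ (UpSet w x l) = ENNReal.ofReal (t l)) ∧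
      ∀ ν : Measure (PathSeq V), IsProbabilityMeasure ν → ν (OmegaSet w x) = 1 →
        (∀ l : List V, IsPathFrom w x l → ν (UpSet w x l) = ENNReal.ofReal (t l)) →
        ν = μ := by
  set L := nhdsWithin r (Set.Ioo 0 r) with hL
  have : L.NeBot := by
    rw [hL, nhdsWithin_Ioo_eq_nhdsLT hr]
    infer_instance
  have hmem : ∀ᶠ s in L, s ∈ Set.Ioo 0 r := self_mem_nhdsWithin
  have hex : ∀ s, ∃ Q : ProbabilityMeasure (PathSeq V),
      s ∈ Set.Ioo 0 r → (Q : Measure (PathSeq V)) = μs s := fun s => by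
    by_cases hs : s ∈ Set.Ioo 0 r
    · exact ⟨⟨μs s, hprob s hs⟩, fun _ => rfl⟩
    · exact ⟨⟨Measure.dirac fun _ => none, inferInstance⟩, fun h => absurd h hs⟩
  choose P hPμ using hex
  have hPs : ∀ᶠ s in L, (P s : Measure (PathSeq V)) = μs s := hmem.mono hPμ
  have hsuppP : ∀ᶠ s in L, (P s : Measure (PathSeq V)) (FinPaths w x) = 1 := by
    filter_upwards [hmem, hPs] with s hs h
    rw [h, hsupp s hs]
  have hconvP : ∀ l : List V, IsPathFrom w x l →
      Tendsto (fun s => ((P s : Measure (PathSeq V)) (Cyl l ∩ FinPaths w x)).toReal)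
        L (𝓝 (t l)) := fun l hl => (hconv l hl).congr' <| by
    filter_upwards [hPs] with s h
    rw [h]
  have hsingletonP : ∀ l : List V, IsPathFrom w x l →
      Tendsto (fun s => (P s : Measure (PathSeq V)) {listToSeq l}) L (𝓝 0) := fun l hl => by
    refine (ENNReal.tendsto_toReal_iff (fun _ => measure_ne_top _ _) ENNReal.zero_ne_top).1 ?_
    refine (hsingleton l hl).congr' ?_
    filter_upwards [hPs] with s h
    rw [h]
  have hlim : ∀ (U : Ultrafilter ℝ), (U : Filter ℝ) ≤ L →
      ∃ μ : ProbabilityMeasure (PathSeq V), Tendsto P U (𝓝 μ) ∧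
        (μ : Measure (PathSeq V)) (OmegaSet w x) = 1 ∧
        ∀ l, IsPathFrom w x l →
          (μ : Measure (PathSeq V)) (UpSet w x l) = ENNReal.ofReal (t l) := by
    intro U hU
    have hμ : Tendsto P U (𝓝 (U.map P).lim) := (U.map P).le_nhds_lim
    have hΩ := limit_omegaSet hμ (hU hsuppP) fun l hl => (hsingletonP l hl).mono_left hU
    exact ⟨_, hμ, hΩ, fun l hl =>
      limit_upSet hμ (hU hsuppP) hΩ ((hconvP l hl).mono_left hU)⟩
  obtain ⟨μ, -, hΩ, hμt⟩ := hlim (Ultrafilter.of L) (Ultrafilter.of_le L)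
  have hP : Tendsto P L (𝓝 μ) := by
    refine tendsto_iff_ultrafilter _ _ _ |>.2 fun U hU => ?_
    obtain ⟨μ', hμ', hΩ', hμt'⟩ := hlim U hU
    have h : (μ' : Measure (PathSeq V)) = μ :=
      ext_of_upSet hΩ' hΩ fun l hl => (hμt' l hl).trans (hμt l hl).symm
    exact (Subtype.ext h : μ' = μ) ▸ hμ'
  refine ⟨μ, inferInstance, hΩ, fun f => ?_, hμt, fun ν _ hνΩ hνt =>
    ext_of_upSet hνΩ hΩ fun l hl => (hνt l hl).trans (hμt l hl).symm⟩
  refine (ProbabilityMeasure.tendsto_iff_forall_integral_tendsto.1 hP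
    (BoundedContinuousFunction.mkOfCompact f)).congr' ?_
  filter_upwards [hPs] with s h
  rw [h]
  rfl
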